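/- arXiv:1207.0666 — 9 statements merged into one kernel-verified Lean document; each statement's English description precedes it below -/
import Mathlib

section
/- The map T : ℍ² → ℍ² defined by T(u,v) = (iv, −iu) (left multiplication by the matrix [[0, i],[−i, 0]]) is right ℍ-linear and self-adjoint, i.e. ⟨Tx|y⟩ = ⟨x|Ty⟩ for all x, y ∈ ℍ². Nevertheless, for every quaternion q = a + cj + dk with a, c, d ∈ ℝ and a² + c² + d² = 1, there exists w = (w₁, w₂) ∈ ℍ² \ {(0,0)} with i·w₂ = q·w₁ and −i·w₁ = q·w₂; that is, the self-adjoint operator T admits every such (generally non-real) quaternion q as a left eigenvalue. -/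
/-- On `ℍ²` (a right `ℍ`-module with the standard Hermitean scalar product
`⟨(r,s)|(u,v)⟩ = r̄u + s̄v`), the map `T(u,v) = (i·v, −i·u)` is right `ℍ`-linear and
self-adjoint, yet for every quaternion `q = a + c·j + d·k` with `a² + c² + d² = 1`
there is a nonzero `w = (w₁,w₂)` with `i·w₂ = q·w₁` and `−i·w₁ = q·w₂`; that is, `T`
admits every such (generally non-real) quaternion as a left eigenvalue. -/
theorem statement2 :
    let mk : ℝ → ℝ → ℝ → ℝ → Quaternion ℝ := fun a b c d => ⟨a, b, c, d⟩
    let qi : Quaternion ℝ := mk 0 1 0 0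
    let T : Quaternion ℝ × Quaternion ℝ → Quaternion ℝ × Quaternion ℝ :=
      fun x => (qi * x.2, -(qi * x.1))
    let inn : Quaternion ℝ × Quaternion ℝ → Quaternion ℝ × Quaternion ℝ → Quaternion ℝ :=
      fun x y => star x.1 * y.1 + star x.2 * y.2
    (∀ (x y : Quaternion ℝ × Quaternion ℝ) (a b : Quaternion ℝ),
      T (x.1 * a + y.1 * b, x.2 * a + y.2 * b) =
        ((T x).1 * a + (T y).1 * b, (T x).2 * a + (T y).2 * b)) ∧
    (∀ x y : Quaternion ℝ × Quaternion ℝ, inn (T x) y = inn x (T y)) ∧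
    (∀ a c d : ℝ, a ^ 2 + c ^ 2 + d ^ 2 = 1 →
      ∃ w : Quaternion ℝ × Quaternion ℝ, w ≠ 0 ∧
        qi * w.2 = mk a 0 c d * w.1 ∧
        -(qi * w.1) = mk a 0 c d * w.2) := by
  intro mk qi T inn
  have re_mk (a b c d : ℝ) : (mk a b c d).re = a := rfl
  have imI_mk (a b c d : ℝ) : (mk a b c d).imI = b := rfl
  have imJ_mk (a b c d : ℝ) : (mk a b c d).imJ = c := rfl
  have imK_mk (a b c d : ℝ) : (mk a b c d).imK = d := rfl
  have star_qi : star qi = -qi := by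
    ext <;> simp [qi, re_mk, imI_mk, imJ_mk, imK_mk]
  refine ⟨fun x y a b => ?_, fun x y => ?_, fun a c d h => ?_⟩
  · simp only [T, mul_add, neg_add, neg_mul, mul_assoc]
  · simp only [T, inn, star_neg, star_mul, star_qi, mul_neg, neg_mul, neg_neg, mul_assoc]
    exact add_comm _ _
  · refine ⟨(1, mk 0 (-a) d (-c)), fun hw => one_ne_zero (congrArg Prod.fst hw), ?_, ?_⟩
    · ext <;> simp [qi, re_mk, imI_mk, imJ_mk, imK_mk]
    · ext <;> simp [qi, re_mk, imI_mk, imJ_mk, imK_mk] <;> linarith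
end

section
/- Let H be a quaternionic pre-Hilbert space and let T : H → H be a right ℍ-linear map such that ⟨u|Tu⟩ ∈ ℝ for every u ∈ H. Then T is symmetric: ⟨Tu|v⟩ = ⟨u|Tv⟩ for all u, v ∈ H. -/
/-- A quaternionic pre-Hilbert space: a right `ℍ`-module `H` (given by an additive group
together with a right scalar multiplication `smul : H → ℍ → H`) equipped with a Hermitean
quaternionic scalar product `inner : H → H → ℍ` which is right `ℍ`-linear in the second
variable, quaternionic Hermitean, and positive definite (`inner u u` is a nonnegative real
number, and `u = 0` whenever `inner u u = 0`). -/
structure QuaternionPreHilbert (H : Type*) [AddCommGroup H] where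
  smul : H → Quaternion ℝ → H
  add_smul : ∀ (u v : H) (q : Quaternion ℝ), smul (u + v) q = smul u q + smul v q
  smul_add : ∀ (u : H) (p q : Quaternion ℝ), smul u (p + q) = smul u p + smul u q
  smul_mul : ∀ (u : H) (p q : Quaternion ℝ), smul u (p * q) = smul (smul u p) q
  smul_one : ∀ u : H, smul u 1 = u
  inner : H → H → Quaternion ℝ
  inner_right_linear : ∀ (u v w : H) (p q : Quaternion ℝ),
    inner u (smul v p + smul w q) = inner u v * p + inner u w * q
  inner_conj : ∀ u v : H, inner u v = star (inner v u)
  inner_self_nonneg : ∀ u : H, ∃ r : ℝ, 0 ≤ r ∧ inner u u = (r : Quaternion ℝ)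
  inner_self_eq_zero : ∀ u : H, inner u u = 0 → u = 0

/-- A map `T : H → H` is right `ℍ`-linear when `T (u·a + v·b) = (T u)·a + (T v)·b`. -/
def QuaternionPreHilbert.IsRightLinear {H : Type*} [AddCommGroup H]
    (P : QuaternionPreHilbert H) (T : H → H) : Prop :=
  ∀ (u v : H) (a b : Quaternion ℝ),
    T (P.smul u a + P.smul v b) = P.smul (T u) a + P.smul (T v) b

namespace QuaternionPreHilbert

variable {H : Type*} [AddCommGroup H] (P : QuaternionPreHilbert H)

theorem inner_add_smul (u v w : H) (q : Quaternion ℝ) :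
    P.inner u (v + P.smul w q) = P.inner u v + P.inner u w * q := by
  simpa [P.smul_one] using P.inner_right_linear u v w 1 q

theorem add_smul_inner (u v w : H) (q : Quaternion ℝ) :
    P.inner (v + P.smul w q) u = P.inner v u + star q * P.inner w u := by
  rw [P.inner_conj, inner_add_smul, star_add, star_mul, ← P.inner_conj, ← P.inner_conj]

theorem IsRightLinear.map_add_smul {P : QuaternionPreHilbert H} {T : H → H}
    (hT : P.IsRightLinear T) (u v : H) (q : Quaternion ℝ) :
    T (u + P.smul v q) = T u + P.smul (T v) q := by
  simpa [P.smul_one] using hT u v 1 q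

end QuaternionPreHilbert

/-- If right multiplication by every quaternion makes `c` self-adjoint, then `c = 0`. -/
theorem Quaternion.eq_zero_of_forall_isSelfAdjoint_mul {c : Quaternion ℝ}
    (hc : ∀ q : Quaternion ℝ, IsSelfAdjoint (c * q)) : c = 0 := by
  have h₁ : star c = c := by simpa using (hc 1).star_eq
  obtain ⟨r, rfl⟩ : ∃ r : ℝ, c = r := ⟨c.re, Quaternion.star_eq_self.mp h₁⟩
  let i : Quaternion ℝ := ⟨0, 1, 0, 0⟩
  have h₂ : (star (r * i)).imI = (r * i).imI := by rw [(hc i).star_eq]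
  have hr : r = 0 := by
    rw [Quaternion.imI_star, Quaternion.coe_mul_eq_smul, Quaternion.imI_smul,
      show i.imI = 1 from rfl, smul_eq_mul, mul_one] at h₂
    linarith
  simp [hr]

/-- If `T : H → H` is a right `ℍ`-linear map on a quaternionic pre-Hilbert
space such that `⟨u|Tu⟩` is real for every `u`, then `T` is symmetric:
`⟨Tu|v⟩ = ⟨u|Tv⟩` for all `u, v`. -/
theorem statement5 {H : Type*} [AddCommGroup H] (P : QuaternionPreHilbert H)
    (T : H → H) (hT : P.IsRightLinear T)
    (h : ∀ u : H, ∃ r : ℝ, P.inner u (T u) = (r : Quaternion ℝ)) :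
    ∀ u v : H, P.inner (T u) v = P.inner u (T v) := by
  intro u v
  have hself (w : H) : star (P.inner w (T w)) = P.inner w (T w) := by
    obtain ⟨r, hr⟩ := h w
    simp [hr]
  have hc : P.inner u (T v) - star (P.inner v (T u)) = 0 := by
    refine Quaternion.eq_zero_of_forall_isSelfAdjoint_mul fun q => ?_
    have hw := hself (u + P.smul v q)
    have hv : star (star q * (P.inner v (T v) * q)) = star q * (P.inner v (T v) * q) := by
      simp only [star_mul, star_star, hself v, mul_assoc]
    simp only [hT.map_add_smul, P.inner_add_smul, P.add_smul_inner, star_add, add_mul,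
      hself u, mul_assoc, hv] at hw
    simp only [star_mul, star_star] at hw
    rw [isSelfAdjoint_iff, sub_mul, star_sub, star_mul, star_mul, star_star]
    rw [← sub_eq_zero] at hw ⊢
    rw [← hw]
    abel
  rw [P.inner_conj (T u) v, sub_eq_zero.mp hc]
end

section
/- Let H be a right ℍ-module, let T : H → H be right ℍ-linear, and for q ∈ ℍ define Δ_q(T) : H → H by Δ_q(T)u = T(Tu) − T(u)·(q + q̄) + u·|q|². Then Ker(Δ_q(T)) ≠ {0} if and only if q is an eigenvalue of T, that is, there exists u ∈ H \ {0} with Tu = uq. (Hence the spherical point spectrum of T coincides with its set of eigenvalues.) -/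
/-- A right `ℍ`-module: an additive abelian group `H` with a right scalar multiplication
`smul : H → ℍ → H` satisfying the module axioms. -/
structure RightQModule (H : Type*) [AddCommGroup H] where
  smul : H → Quaternion ℝ → H
  add_smul : ∀ (u v : H) (q : Quaternion ℝ), smul (u + v) q = smul u q + smul v q
  smul_add : ∀ (u : H) (p q : Quaternion ℝ), smul u (p + q) = smul u p + smul u q
  smul_mul : ∀ (u : H) (p q : Quaternion ℝ), smul u (p * q) = smul (smul u p) q
  smul_one : ∀ u : H, smul u 1 = u

/-- A map `T : H → H` is right `ℍ`-linear when `T (u·a + v·b) = (T u)·a + (T v)·b`. -/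
def RightQModule.IsRightLinear {H : Type*} [AddCommGroup H]
    (M : RightQModule H) (T : H → H) : Prop :=
  ∀ (u v : H) (a b : Quaternion ℝ),
    T (M.smul u a + M.smul v b) = M.smul (T u) a + M.smul (T v) b

namespace RightQModule

variable {H : Type*} [AddCommGroup H] (M : RightQModule H)

theorem zero_smul (q : Quaternion ℝ) : M.smul 0 q = 0 := by
  simpa using M.add_smul 0 0 q

theorem smul_zero (u : H) : M.smul u 0 = 0 := by
  simpa using M.smul_add u 0 0

theorem sub_smul (u v : H) (q : Quaternion ℝ) :
    M.smul (u - v) q = M.smul u q - M.smul v q := by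
  rw [eq_sub_iff_add_eq, ← M.add_smul, sub_add_cancel]

theorem smul_ne_zero {u : H} (hu : u ≠ 0) {a : Quaternion ℝ} (ha : a ≠ 0) :
    M.smul u a ≠ 0 := by
  intro h
  apply hu
  rw [← M.smul_one u, ← mul_inv_cancel₀ ha, M.smul_mul, h, M.zero_smul]

variable {M} {T : H → H}

theorem IsRightLinear.map_smul (hT : M.IsRightLinear T) (u : H) (a : Quaternion ℝ) :
    T (M.smul u a) = M.smul (T u) a := by
  simpa [M.smul_zero] using hT u 0 a 0

theorem IsRightLinear.map_add (hT : M.IsRightLinear T) (u v : H) : T (u + v) = T u + T v := by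
  simpa [M.smul_one] using hT u v 1 1

theorem IsRightLinear.map_sub (hT : M.IsRightLinear T) (u v : H) : T (u - v) = T u - T v := by
  rw [eq_sub_iff_add_eq, ← hT.map_add, sub_add_cancel]

end RightQModule

theorem Quaternion.coe_norm_sq_eq_mul_star (q : Quaternion ℝ) :
    ((‖q‖ ^ 2 : ℝ) : Quaternion ℝ) = q * star q := by
  rw [Quaternion.self_mul_star, Quaternion.normSq_eq_norm_mul_self, sq]

theorem Quaternion.coe_norm_sq_eq_star_mul (q : Quaternion ℝ) :
    ((‖q‖ ^ 2 : ℝ) : Quaternion ℝ) = star q * q := by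
  rw [Quaternion.star_mul_self, Quaternion.normSq_eq_norm_mul_self, sq]

theorem Quaternion.star_mul_eq_mul_of_orthogonal {q a : Quaternion ℝ} (ha : a.re = 0)
    (h : q.imI * a.imI + q.imJ * a.imJ + q.imK * a.imK = 0) : star q * a = a * q := by
  ext <;> simp [ha] <;> linarith

/-- Every quaternion is similar to its conjugate. -/
theorem Quaternion.exists_ne_zero_star_mul_eq_mul (q : Quaternion ℝ) :
    ∃ a : Quaternion ℝ, a ≠ 0 ∧ star q * a = a * q := by
  by_cases h : q.imI = 0 ∧ q.imJ = 0
  · refine ⟨⟨0, 1, 0, 0⟩, fun h0 => ?_, star_mul_eq_mul_of_orthogonal rfl (by simp [h.1])⟩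
    simpa using congrArg QuaternionAlgebra.imI h0
  · refine ⟨⟨0, -q.imJ, q.imI, 0⟩, fun h0 => h ⟨?_, ?_⟩,
      star_mul_eq_mul_of_orthogonal rfl (by dsimp only; ring)⟩
    · simpa using congrArg QuaternionAlgebra.imJ h0
    · simpa using congrArg QuaternionAlgebra.imI h0

/-- For a right `ℍ`-linear map `T` on a right `ℍ`-module `H` and `q ∈ ℍ`,
let `Δ_q(T) u = T(Tu) − (Tu)·(q + q̄) + u·|q|²`. Then `Ker (Δ_q(T)) ≠ {0}` if and only if
`q` is an eigenvalue of `T`, i.e. there is `u ≠ 0` with `Tu = u·q`. -/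
theorem statement7 {H : Type*} [AddCommGroup H] (M : RightQModule H)
    (T : H → H) (hT : M.IsRightLinear T) (q : Quaternion ℝ) :
    (∃ u : H, u ≠ 0 ∧
        T (T u) - M.smul (T u) (q + star q) + M.smul u ((‖q‖ ^ 2 : ℝ) : Quaternion ℝ) = 0)
      ↔ (∃ u : H, u ≠ 0 ∧ T u = M.smul u q) := by
  constructor
  · rintro ⟨u, hu, h⟩
    by_cases hw : T u - M.smul u (star q) = 0
    · obtain ⟨a, ha, haq⟩ := Quaternion.exists_ne_zero_star_mul_eq_mul q
      refine ⟨M.smul u a, M.smul_ne_zero hu ha, ?_⟩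
      rw [hT.map_smul, sub_eq_zero.mp hw, ← M.smul_mul, ← M.smul_mul, haq]
    · refine ⟨T u - M.smul u (star q), hw, ?_⟩
      rw [Quaternion.coe_norm_sq_eq_star_mul, M.smul_add] at h
      rw [hT.map_sub, hT.map_smul, M.sub_smul, ← M.smul_mul, ← sub_eq_zero, ← h]
      abel
  · rintro ⟨u, hu, h⟩
    refine ⟨u, hu, ?_⟩
    rw [Quaternion.coe_norm_sq_eq_mul_star, h, hT.map_smul, h, ← M.smul_mul, ← M.smul_mul,
      mul_add, M.smul_add]
    abel
end

section
/- Let H ≠ {0} be a quaternionic pre-Hilbert space, let J : H → H be right ℍ-linear with J(Ju) = −u for all u ∈ H and ⟨Ju|v⟩ = −⟨u|Jv⟩ for all u, v ∈ H (J anti self-adjoint with J² = −I), and let ι ∈ 𝕊. Then the set H₊^{Jι} = {u ∈ H : Ju = uι} contains a nonzero vector, it is closed under addition and under right multiplication by elements of ℂ_ι, and ⟨u|v⟩ ∈ ℂ_ι for all u, v ∈ H₊^{Jι}; thus the restriction of ⟨·|·⟩ makes H₊^{Jι} a ℂ_ι-pre-Hilbert space. The analogous statement holds for H₋^{Jι}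 = {u ∈ H : Ju = −uι}. -/
namespace QuaternionPreHilbert

open Quaternion

theorem re_eq_zero_and_sum_sq_of_sq_eq_neg_one {ι : ℍ[ℝ]} (hι : ι ^ 2 = -1) :
    ι.re = 0 ∧ ι.imI ^ 2 + ι.imJ ^ 2 + ι.imK ^ 2 = 1 := by
  rw [pow_two, Quaternion.ext_iff] at hι
  obtain ⟨h1, h2, h3, h4⟩ := hι
  simp only [re_mul, imI_mul, imJ_mul, imK_mul, re_neg, imI_neg, imJ_neg, imK_neg,
    re_one, imI_one, imJ_one, imK_one, neg_zero] at h1 h2 h3 h4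
  have h : ι.re = 0 := by
    by_contra h
    have hI : ι.imI = 0 := mul_left_cancel₀ h (by linarith)
    have hJ : ι.imJ = 0 := mul_left_cancel₀ h (by linarith)
    have hK : ι.imK = 0 := mul_left_cancel₀ h (by linarith)
    rw [hI, hJ, hK] at h1
    nlinarith [sq_nonneg ι.re]
  refine ⟨h, ?_⟩
  rw [h] at h1
  linarith

theorem star_eq_neg_of_sq_eq_neg_one {ι : ℍ[ℝ]} (hι : ι ^ 2 = -1) : star ι = -ι :=
  star_eq_neg.2 (re_eq_zero_and_sum_sq_of_sq_eq_neg_one hι).1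

/-- An element commuting with an imaginary unit `ι` lies in the plane `ℂ_ι`. -/
theorem exists_eq_add_smul_of_commute {ι q : ℍ[ℝ]} (hι : ι ^ 2 = -1) (hq : ι * q = q * ι) :
    ∃ α β : ℝ, q = (α : ℍ[ℝ]) + β • ι := by
  obtain ⟨h0, h1⟩ := re_eq_zero_and_sum_sq_of_sq_eq_neg_one hι
  refine ⟨q.re, q.imI * ι.imI + q.imJ * ι.imJ + q.imK * ι.imK, ?_⟩
  rw [Quaternion.ext_iff] at hq
  obtain ⟨-, h2, h3, h4⟩ := hq
  simp only [imI_mul, imJ_mul, imK_mul, h0] at h2 h3 h4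
  ext
  · simp [h0]
  · simp only [imI_add, imI_coe, imI_smul, smul_eq_mul]
    linear_combination (-q.imI) * h1 + (-ι.imJ / 2) * h4 + (ι.imK / 2) * h3
  · simp only [imJ_add, imJ_coe, imJ_smul, smul_eq_mul]
    linear_combination (-q.imJ) * h1 + (-ι.imK / 2) * h2 + (ι.imI / 2) * h4
  · simp only [imK_add, imK_coe, imK_smul, smul_eq_mul]
    linear_combination (-q.imK) * h1 + (-ι.imI / 2) * h3 + (ι.imJ / 2) * h2

theorem exists_ne_zero_anticommute {ι : ℍ[ℝ]} (hι : ι ^ 2 = -1) :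
    ∃ κ : ℍ[ℝ], κ ≠ 0 ∧ ι * κ = -(κ * ι) := by
  have anticommute : ∀ q : ℍ[ℝ], ι * (q + ι * q * ι) = -((q + ι * q * ι) * ι) := fun q => by
    have h : ι * ι = -1 := by rw [← pow_two, hι]
    have h1 : ι * (ι * q * ι) = -(q * ι) := by
      rw [← mul_assoc, ← mul_assoc, h, neg_one_mul, neg_mul]
    have h2 : ι * q * ι * ι = -(ι * q) := by rw [mul_assoc, h, mul_neg_one]
    rw [mul_add, add_mul, h1, h2]
    abel
  by_contra! hne
  have commute : ∀ q : ℍ[ℝ], ι * q = q * ι := fun q => by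
    have h : ι * ι = -1 := by rw [← pow_two, hι]
    have hz : q + ι * q * ι = 0 := by
      by_contra hz
      exact hne _ hz (anticommute q)
    have hz' : (q + ι * q * ι) * ι = 0 := by rw [hz, zero_mul]
    rw [add_mul, mul_assoc (ι * q), h, mul_neg_one, ← sub_eq_add_neg, sub_eq_zero] at hz'
    exact hz'.symm
  obtain ⟨h0, h1⟩ := re_eq_zero_and_sum_sq_of_sq_eq_neg_one hι
  have hc := fun q => Quaternion.ext_iff.1 (commute q)
  simp only [imI_mul, imJ_mul, imK_mul] at hc
  obtain ⟨-, -, hK, hJ⟩ := hc ⟨0, 1, 0, 0⟩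
  obtain ⟨-, -, -, hI⟩ := hc ⟨0, 0, 1, 0⟩
  simp only [mul_zero, zero_mul, mul_one, one_mul, add_zero, zero_add, sub_zero] at hI hJ hK
  nlinarith

variable {H : Type*} [AddCommGroup H] (P : QuaternionPreHilbert H)

theorem smul_zero (u : H) : P.smul u 0 = 0 := by
  simpa using P.smul_add u 0 0

theorem zero_smul (q : ℍ[ℝ]) : P.smul 0 q = 0 := by
  simpa using P.add_smul 0 0 q

theorem smul_neg (u : H) (q : ℍ[ℝ]) : P.smul u (-q) = -P.smul u q := by
  rw [eq_neg_iff_add_eq_zero, ← P.smul_add, neg_add_cancel, P.smul_zero]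

theorem neg_smul (u : H) (q : ℍ[ℝ]) : P.smul (-u) q = -P.smul u q := by
  rw [eq_neg_iff_add_eq_zero, ← P.add_smul, neg_add_cancel, P.zero_smul]

theorem smul_ne_zero {u : H} {q : ℍ[ℝ]} (hu : u ≠ 0) (hq : q ≠ 0) : P.smul u q ≠ 0 := by
  intro h
  apply hu
  rw [← P.smul_one u, ← mul_inv_cancel₀ hq, P.smul_mul, h, P.zero_smul]

theorem inner_smul_right (u v : H) (q : ℍ[ℝ]) : P.inner u (P.smul v q) = P.inner u v * q := by
  simpa [P.smul_zero] using P.inner_right_linear u v v q 0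

variable {P} {J : H → H}

theorem IsRightLinear.map_add (hJ : P.IsRightLinear J) (u v : H) : J (u + v) = J u + J v := by
  simpa [P.smul_one] using hJ u v 1 1

theorem IsRightLinear.map_smul (hJ : P.IsRightLinear J) (u : H) (q : ℍ[ℝ]) :
    J (P.smul u q) = P.smul (J u) q := by
  simpa [P.smul_zero] using hJ u u q 0

theorem IsRightLinear.exists_ne_zero_map_eq_smul (hJ : P.IsRightLinear J)
    (hJJ : ∀ u : H, J (J u) = -u) (hH : ∃ u : H, u ≠ 0) {ι : ℍ[ℝ]} (hι : ι ^ 2 = -1) :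
    ∃ u : H, J u = P.smul u ι ∧ u ≠ 0 := by
  obtain ⟨u, hu⟩ := hH
  by_cases hw : u + P.smul (J u) (-ι) = 0
  · obtain ⟨κ, hκ, h⟩ := exists_ne_zero_anticommute hι
    refine ⟨P.smul u κ, ?_, P.smul_ne_zero hu hκ⟩
    have hJu : J u = -P.smul u ι := by
      have h2 : J (u + P.smul (J u) (-ι)) = J u + P.smul u ι := by
        rw [hJ.map_add, hJ.map_smul, hJJ, P.neg_smul, P.smul_neg, neg_neg]
      have h0 : J 0 = 0 := by simpa using hJ.map_add 0 0
      rw [hw, h0] at h2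
      exact eq_neg_of_add_eq_zero_left h2.symm
    rw [hJ.map_smul, hJu, P.neg_smul, ← P.smul_mul, ← P.smul_mul, h, P.smul_neg, neg_neg]
  · refine ⟨_, ?_, hw⟩
    rw [hJ.map_add, hJ.map_smul, hJJ, P.add_smul, ← P.smul_mul, neg_mul, ← pow_two, hι, neg_neg,
      P.smul_one, P.neg_smul, P.smul_neg, neg_neg, add_comm]

theorem IsRightLinear.map_smul_eq_smul (hJ : P.IsRightLinear J) {ι c : ℍ[ℝ]}
    (hc : ∃ α β : ℝ, c = (α : ℍ[ℝ]) + β • ι) {u : H} (hu : J u = P.smul u ι) :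
    J (P.smul u c) = P.smul (P.smul u c) ι := by
  obtain ⟨α, β, rfl⟩ := hc
  rw [hJ.map_smul, hu, ← P.smul_mul, ← P.smul_mul, mul_add, add_mul, mul_smul_comm,
    smul_mul_assoc, (Quaternion.coe_commutes α ι)]

theorem exists_inner_eq_add_smul (hJanti : ∀ u v : H, P.inner (J u) v = -P.inner u (J v))
    {ι : ℍ[ℝ]} (hι : ι ^ 2 = -1) {u v : H} (hu : J u = P.smul u ι) (hv : J v = P.smul v ι) :
    ∃ α β : ℝ, P.inner u v = (α : ℍ[ℝ]) + β • ι := by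
  apply exists_eq_add_smul_of_commute hι
  have h := hJanti u v
  rw [hu, hv, P.inner_conj, P.inner_smul_right, P.inner_smul_right, star_mul, ← P.inner_conj,
    star_eq_neg_of_sq_eq_neg_one hι, neg_mul] at h
  exact neg_injective h

theorem IsRightLinear.eigenspace_properties (hJ : P.IsRightLinear J)
    (hJJ : ∀ u : H, J (J u) = -u) (hJanti : ∀ u v : H, P.inner (J u) v = -P.inner u (J v))
    (hH : ∃ u : H, u ≠ 0) {ι : ℍ[ℝ]} (hι : ι ^ 2 = -1) :
    let Cι : Set ℍ[ℝ] := {c | ∃ α β : ℝ, c = (α : ℍ[ℝ]) + β • ι}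
    let Hp : Set H := {u | J u = P.smul u ι}
    (∃ u ∈ Hp, u ≠ 0) ∧
      (∀ u ∈ Hp, ∀ v ∈ Hp, u + v ∈ Hp) ∧
      (∀ u ∈ Hp, ∀ c ∈ Cι, P.smul u c ∈ Hp) ∧
      (∀ u ∈ Hp, ∀ v ∈ Hp, P.inner u v ∈ Cι) := by
  refine ⟨hJ.exists_ne_zero_map_eq_smul hJJ hH hι, fun u hu v hv => ?_,
    fun u hu c hc => hJ.map_smul_eq_smul hc hu,
    fun u hu v hv => exists_inner_eq_add_smul hJanti hι hu hv⟩
  change J u = P.smul u ι at hu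
  change J v = P.smul v ι at hv
  change J (u + v) = P.smul (u + v) ι
  rw [hJ.map_add, hu, hv, P.add_smul]

end QuaternionPreHilbert

/-- Let `H ≠ {0}` be a quaternionic pre-Hilbert space, `J : H → H` right
`ℍ`-linear, anti self-adjoint (`⟨Ju|v⟩ = −⟨u|Jv⟩`) with `J² = −I`, and `ι ∈ 𝕊`. Then
`H₊^{Jι} = {u : Ju = u·ι}` contains a nonzero vector, is closed under addition and under
right multiplication by elements of `ℂ_ι`, and `⟨u|v⟩ ∈ ℂ_ι` for all `u, v ∈ H₊^{Jι}`;
the analogous statement holds for `H₋^{Jι} = {u : Ju = −u·ι}`. -/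
theorem statement9 {H : Type*} [AddCommGroup H] (P : QuaternionPreHilbert H)
    (hH : ∃ u : H, u ≠ 0)
    (J : H → H) (hJlin : P.IsRightLinear J)
    (hJJ : ∀ u : H, J (J u) = -u)
    (hJanti : ∀ u v : H, P.inner (J u) v = -P.inner u (J v))
    (ι : Quaternion ℝ) (hι : ι ^ 2 = -1) :
    let Cι : Set (Quaternion ℝ) := {c | ∃ α β : ℝ, c = (α : Quaternion ℝ) + β • ι}
    let Hp : Set H := {u | J u = P.smul u ι}
    let Hm : Set H := {u | J u = -P.smul u ι}
    ((∃ u ∈ Hp, u ≠ 0) ∧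
      (∀ u ∈ Hp, ∀ v ∈ Hp, u + v ∈ Hp) ∧
      (∀ u ∈ Hp, ∀ c ∈ Cι, P.smul u c ∈ Hp) ∧
      (∀ u ∈ Hp, ∀ v ∈ Hp, P.inner u v ∈ Cι)) ∧
    ((∃ u ∈ Hm, u ≠ 0) ∧
      (∀ u ∈ Hm, ∀ v ∈ Hm, u + v ∈ Hm) ∧
      (∀ u ∈ Hm, ∀ c ∈ Cι, P.smul u c ∈ Hm) ∧
      (∀ u ∈ Hm, ∀ v ∈ Hm, P.inner u v ∈ Cι)) := by
  intro Cι Hp Hm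
  have hC : Cι = {c | ∃ α β : ℝ, c = (α : Quaternion ℝ) + β • (-ι)} := by
    ext c
    constructor
    · rintro ⟨α, β, rfl⟩
      exact ⟨α, -β, by simp⟩
    · rintro ⟨α, β, rfl⟩
      exact ⟨α, -β, by simp⟩
  have hHm : Hm = {u | J u = P.smul u (-ι)} := by
    simp only [Hm, P.smul_neg]
  refine ⟨hJlin.eigenspace_properties hJJ hJanti hH hι, ?_⟩
  rw [hHm, hC]
  exact hJlin.eigenspace_properties hJJ hJanti hH (by rw [neg_sq, hι])
end

section
/- (Representation formula) Let K ⊆ ℂ be nonempty and invariant under complex conjugation, and let f = 𝓘(F₁ + iF₂) : Ω_K → ℍ be the slice function induced by a stem function F₁ + iF₂ on K. Then for all α, β ∈ ℝ with α + iβ ∈ K and all ι, j ∈ 𝕊: f(α + ιβ) = (f(α + jβ) + f(α − jβ))·(1/2) − ι·(j·(f(α + jβ) − f(α − jβ))·(1/2)). In particular, if two slice functions on Ω_K coincide on Ω_K ∩ ℂ_j for a single j ∈ 𝕊, then they coincide on all of Ω_K. -/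
/-- A function of the form `A + j * B` on the imaginary units `j` is determined by its values at
`j` and `-j`. -/
theorem Quaternion.add_unit_mul_eq (A B ι j : Quaternion ℝ) (hj : j ^ 2 = -1) :
    A + ι * B = ((A + j * B) + (A - j * B)) * (((1 : ℝ) / 2 : ℝ) : Quaternion ℝ)
      - ι * (j * (((A + j * B) - (A - j * B)) * (((1 : ℝ) / 2 : ℝ) : Quaternion ℝ))) := by
  have half_double (x : Quaternion ℝ) : (x + x) * (((1 : ℝ) / 2 : ℝ) : Quaternion ℝ) = x := by
    rw [Quaternion.mul_coe_eq_smul, ← two_smul ℝ x, smul_smul]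
    norm_num
  have hsum : (A + j * B) + (A - j * B) = A + A := by abel
  have hdiff : (A + j * B) - (A - j * B) = j * B + j * B := by abel
  rw [hsum, hdiff, half_double, half_double, ← mul_assoc j j B, ← sq, hj]
  simp

/-- The representation formula for slice functions. -/
theorem Quaternion.slice_representation (K : Set ℂ) (F₁ F₂ : ℂ → Quaternion ℝ)
    (f : Quaternion ℝ → Quaternion ℝ)
    (hf : ∀ (α β : ℝ) (j : Quaternion ℝ), j ^ 2 = -1 → (α : ℂ) + β * Complex.I ∈ K →
      f ((α : Quaternion ℝ) + β • j) =
        F₁ ((α : ℂ) + β * Complex.I) + j * F₂ ((α : ℂ) + β * Complex.I))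
    (α β : ℝ) (ι j : Quaternion ℝ) (hι : ι ^ 2 = -1) (hj : j ^ 2 = -1)
    (hz : (α : ℂ) + β * Complex.I ∈ K) :
    f ((α : Quaternion ℝ) + β • ι) =
      (f ((α : Quaternion ℝ) + β • j) + f ((α : Quaternion ℝ) - β • j))
          * (((1 : ℝ) / 2 : ℝ) : Quaternion ℝ)
        - ι * (j * ((f ((α : Quaternion ℝ) + β • j) - f ((α : Quaternion ℝ) - β • j))
          * (((1 : ℝ) / 2 : ℝ) : Quaternion ℝ))) := by
  have hneg := hf α β (-j) (by rw [neg_sq, hj]) hz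
  rw [smul_neg, neg_mul, ← sub_eq_add_neg, ← sub_eq_add_neg] at hneg
  rw [hf α β ι hι hz, hf α β j hj hz, hneg]
  exact Quaternion.add_unit_mul_eq _ _ ι j hj

/-- representation formula for slice functions. Let `K ⊆ ℂ` be nonempty
and invariant under complex conjugation, and let `f` be the slice function on the
circularization `Ω_K` induced by a stem function `F₁ + iF₂` on `K`. Then for all
`α, β ∈ ℝ` with `α + iβ ∈ K` and all `ι, j ∈ 𝕊`:
`f(α + ιβ) = (f(α + jβ) + f(α − jβ))·(1/2) − ι·(j·(f(α + jβ) − f(α − jβ))·(1/2))`.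
In particular, two slice functions on `Ω_K` coinciding on `Ω_K ∩ ℂ_{j₀}` for one
`j₀ ∈ 𝕊` coincide on all of `Ω_K`. -/
theorem statement12 (K : Set ℂ) (hK : K.Nonempty)
    (hKconj : ∀ z ∈ K, (starRingEnd ℂ) z ∈ K)
    (F₁ F₂ : ℂ → Quaternion ℝ)
    (hF₁ : ∀ z ∈ K, F₁ ((starRingEnd ℂ) z) = F₁ z)
    (hF₂ : ∀ z ∈ K, F₂ ((starRingEnd ℂ) z) = -F₂ z)
    (f : Quaternion ℝ → Quaternion ℝ)
    (hf : ∀ (α β : ℝ) (j : Quaternion ℝ), j ^ 2 = -1 → (α : ℂ) + β * Complex.I ∈ K →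
      f ((α : Quaternion ℝ) + β • j) =
        F₁ ((α : ℂ) + β * Complex.I) + j * F₂ ((α : ℂ) + β * Complex.I)) :
    (∀ (α β : ℝ) (ι j : Quaternion ℝ), ι ^ 2 = -1 → j ^ 2 = -1 →
      (α : ℂ) + β * Complex.I ∈ K →
      f ((α : Quaternion ℝ) + β • ι) =
        (f ((α : Quaternion ℝ) + β • j) + f ((α : Quaternion ℝ) - β • j))
            * (((1 : ℝ) / 2 : ℝ) : Quaternion ℝ)
          - ι * (j * ((f ((α : Quaternion ℝ) + β • j) - f ((α : Quaternion ℝ) - β • j))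
            * (((1 : ℝ) / 2 : ℝ) : Quaternion ℝ)))) ∧
    (∀ (G₁ G₂ : ℂ → Quaternion ℝ) (g : Quaternion ℝ → Quaternion ℝ),
      (∀ z ∈ K, G₁ ((starRingEnd ℂ) z) = G₁ z) →
      (∀ z ∈ K, G₂ ((starRingEnd ℂ) z) = -G₂ z) →
      (∀ (α β : ℝ) (j : Quaternion ℝ), j ^ 2 = -1 → (α : ℂ) + β * Complex.I ∈ K →
        g ((α : Quaternion ℝ) + β • j) =
          G₁ ((α : ℂ) + β * Complex.I) + j * G₂ ((α : ℂ) + β * Complex.I)) →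
      ∀ j₀ : Quaternion ℝ, j₀ ^ 2 = -1 →
        (∀ α β : ℝ, (α : ℂ) + β * Complex.I ∈ K →
          f ((α : Quaternion ℝ) + β • j₀) = g ((α : Quaternion ℝ) + β • j₀)) →
        ∀ (α β : ℝ) (j : Quaternion ℝ), j ^ 2 = -1 → (α : ℂ) + β * Complex.I ∈ K →
          f ((α : Quaternion ℝ) + β • j) = g ((α : Quaternion ℝ) + β • j)) := by
  refine ⟨Quaternion.slice_representation K F₁ F₂ f hf, ?_⟩
  intro G₁ G₂ g _ _ hg j₀ hj₀ hfg α β j hj hz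
  have hconj : (α : ℂ) + ((-β : ℝ) : ℂ) * Complex.I ∈ K := by
    simpa using hKconj _ hz
  have hneg := hfg α (-β) hconj
  rw [neg_smul, ← sub_eq_add_neg] at hneg
  rw [Quaternion.slice_representation K F₁ F₂ f hf α β j j₀ hj hj₀ hz,
    Quaternion.slice_representation K G₁ G₂ g hg α β j j₀ hj hj₀ hz, hfg α β hz, hneg]
end

section
/- Let K ⊆ ℂ be nonempty and invariant under complex conjugation and let {1, j, κ, δ} be a real vector-space basis of ℍ. Then the map (f₀, f₁, f₂, f₃) ↦ f₀ + f₁j + f₂κ + f₃δ (pointwise operations) is a bijection from quadruples of continuous ℍ-intrinsic slice functions on Ω_K onto the set of continuous slice functions on Ω_K; in particular every continuous slice function f on Ω_K has a unique such decomposition. Moreover: (a) if j ∈ 𝕊, then f is a ℂ_j-slice function if and only if f₂ = f₃ = 0; (b) f is a circular slice function if and only if f₀, f₁, f₂, f₃ are real-valued. -/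
/-- The circularization `Ω_K ⊆ ℍ` of a set `K ⊆ ℂ`. -/
def OmegaK (K : Set ℂ) : Set (Quaternion ℝ) :=
  {q | ∃ (α β : ℝ) (j : Quaternion ℝ),
    j ^ 2 = -1 ∧ (α : ℂ) + β * Complex.I ∈ K ∧ q = (α : Quaternion ℝ) + β • j}

/-- `F₁ + iF₂` is a continuous stem function on `K`. -/
def IsContStem (K : Set ℂ) (F₁ F₂ : ℂ → Quaternion ℝ) : Prop :=
  ContinuousOn F₁ K ∧ ContinuousOn F₂ K ∧
  (∀ z ∈ K, F₁ ((starRingEnd ℂ) z) = F₁ z) ∧ (∀ z ∈ K, F₂ ((starRingEnd ℂ) z) = -F₂ z)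

/-- The stem function `F₁ + iF₂` induces the function `f : Ω_K → ℍ` as a slice function. -/
def InducesSlice (K : Set ℂ) (F₁ F₂ : ℂ → Quaternion ℝ)
    (f : OmegaK K → Quaternion ℝ) : Prop :=
  ∀ (q : OmegaK K) (α β : ℝ) (j : Quaternion ℝ), j ^ 2 = -1 →
    (α : ℂ) + β * Complex.I ∈ K → (q : Quaternion ℝ) = (α : Quaternion ℝ) + β • j →
    f q = F₁ ((α : ℂ) + β * Complex.I) + j * F₂ ((α : ℂ) + β * Complex.I)

/-- The set of continuous slice functions on `Ω_K`. -/
def SliceCont (K : Set ℂ) : Set (OmegaK K → Quaternion ℝ) :=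
  {f | ∃ F₁ F₂ : ℂ → Quaternion ℝ, IsContStem K F₁ F₂ ∧ InducesSlice K F₁ F₂ f}

/-- The set of continuous `ℍ`-intrinsic slice functions on `Ω_K`
(stem components real-valued on `K`). -/
def SliceContIntrinsic (K : Set ℂ) : Set (OmegaK K → Quaternion ℝ) :=
  {f | ∃ F₁ F₂ : ℂ → Quaternion ℝ, IsContStem K F₁ F₂ ∧
    (∀ z ∈ K, F₁ z = ((F₁ z).re : Quaternion ℝ)) ∧
    (∀ z ∈ K, F₂ z = ((F₂ z).re : Quaternion ℝ)) ∧ InducesSlice K F₁ F₂ f}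

/-- The set of continuous `ℂ_j`-slice functions on `Ω_K`
(stem components `ℂ_j`-valued on `K`). -/
def SliceContCj (K : Set ℂ) (j : Quaternion ℝ) : Set (OmegaK K → Quaternion ℝ) :=
  {f | ∃ F₁ F₂ : ℂ → Quaternion ℝ, IsContStem K F₁ F₂ ∧
    (∀ z ∈ K, ∃ a b : ℝ, F₁ z = (a : Quaternion ℝ) + b • j) ∧
    (∀ z ∈ K, ∃ a b : ℝ, F₂ z = (a : Quaternion ℝ) + b • j) ∧ InducesSlice K F₁ F₂ f}

/-- The set of continuous circular slice functions on `Ω_K` (second stem component zero). -/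
def SliceContCircular (K : Set ℂ) : Set (OmegaK K → Quaternion ℝ) :=
  {f | ∃ F₁ F₂ : ℂ → Quaternion ℝ, IsContStem K F₁ F₂ ∧
    (∀ z ∈ K, F₂ z = 0) ∧ InducesSlice K F₁ F₂ f}

/-- A quaternion squaring to `-1` is purely imaginary. -/
theorem re_eq_zero_of_sq_eq_neg_one {j : Quaternion ℝ} (hj : j ^ 2 = -1) : j.re = 0 := by
  by_contra hne
  rw [pow_two] at hj
  have h0 := congrArg (fun q : Quaternion ℝ => q.re) hj
  have h1 := congrArg (fun q : Quaternion ℝ => q.imI) hj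
  have h2 := congrArg (fun q : Quaternion ℝ => q.imJ) hj
  have h3 := congrArg (fun q : Quaternion ℝ => q.imK) hj
  simp only [Quaternion.re_mul, Quaternion.imI_mul, Quaternion.imJ_mul, Quaternion.imK_mul,
    Quaternion.re_neg, Quaternion.imI_neg, Quaternion.imJ_neg, Quaternion.imK_neg,
    Quaternion.re_one, Quaternion.imI_one, Quaternion.imJ_one, Quaternion.imK_one] at h0 h1 h2 h3
  have e1 : j.imI = 0 := mul_left_cancel₀ hne (by linarith)
  have e2 : j.imJ = 0 := mul_left_cancel₀ hne (by linarith)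
  have e3 : j.imK = 0 := mul_left_cancel₀ hne (by linarith)
  rw [e1, e2, e3] at h0
  nlinarith [sq_nonneg j.re]

theorem ne_zero_of_sq_eq_neg_one {j : Quaternion ℝ} (hj : j ^ 2 = -1) : j ≠ 0 := by
  rintro rfl
  norm_num at hj

theorem exists_sq_eq_neg_one : ∃ j : Quaternion ℝ, j ^ 2 = -1 := by
  let i : Quaternion ℝ := ⟨0, 1, 0, 0⟩
  have h : i * i = -1 := by
    ext <;> simp only [Quaternion.re_mul, Quaternion.imI_mul, Quaternion.imJ_mul,
      Quaternion.imK_mul, Quaternion.re_neg, Quaternion.imI_neg, Quaternion.imJ_neg,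
      Quaternion.imK_neg, Quaternion.re_one, Quaternion.imI_one, Quaternion.imJ_one,
      Quaternion.imK_one] <;> norm_num [i]
  exact ⟨i, (pow_two i).trans h⟩

/-- The representations `α + βj` of a quaternion agree up to a sign of `β` and `j`. -/
theorem slice_coordinates {α β α' β' : ℝ} {j j' : Quaternion ℝ} (hj : j ^ 2 = -1)
    (hj' : j' ^ 2 = -1) (h : (α : Quaternion ℝ) + β • j = (α' : Quaternion ℝ) + β' • j') :
    α = α' ∧ ((β = 0 ∧ β' = 0) ∨ (β = β' ∧ j = j') ∨ (β = -β' ∧ j = -j')) := by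
  have hα : α = α' := by
    have := congrArg (fun q : Quaternion ℝ => q.re) h
    simpa [re_eq_zero_of_sq_eq_neg_one hj, re_eq_zero_of_sq_eq_neg_one hj'] using this
  subst hα
  refine ⟨rfl, ?_⟩
  have h2 : β • j = β' • j' := add_left_cancel h
  have hsq : β ^ 2 = β' ^ 2 := by
    have h3 : (β • j) ^ 2 = (β' • j') ^ 2 := by rw [h2]
    rw [smul_pow, smul_pow, hj, hj'] at h3
    have hre := congrArg (fun q : Quaternion ℝ => q.re) h3
    simp only [Quaternion.re_smul, Quaternion.re_neg, Quaternion.re_one, smul_eq_mul] at hre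
    linarith
  by_cases hβ : β = 0
  · left
    subst hβ
    exact ⟨rfl, by simpa using hsq.symm⟩
  right
  rcases sq_eq_sq_iff_eq_or_eq_neg.1 hsq with e | e
  · left
    subst e
    exact ⟨rfl, smul_right_injective _ hβ h2⟩
  · right
    refine ⟨e, smul_right_injective _ hβ ?_⟩
    beta_reduce
    rw [h2, e, neg_smul_neg]

/-- The point of `Ω_K` lying over `z ∈ K` in the direction of the imaginary unit `i`. -/
theorem exists_point_over {K : Set ℂ} {z : ℂ} (hz : z ∈ K) {i : Quaternion ℝ} (hi : i ^ 2 = -1) :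
    ∃ q : OmegaK K, ∀ (F₁ F₂ : ℂ → Quaternion ℝ) (f : OmegaK K → Quaternion ℝ),
      InducesSlice K F₁ F₂ f → f q = F₁ z + i * F₂ z := by
  have hz' : (z.re : ℂ) + z.im * Complex.I ∈ K := by rwa [Complex.re_add_im]
  refine ⟨⟨_, z.re, z.im, i, hi, hz', rfl⟩, fun F₁ F₂ f hf => ?_⟩
  simpa only [Complex.re_add_im] using hf _ z.re z.im i hi hz' rfl

/-- The components of a stem function are determined on `K` by the induced slice function. -/
theorem InducesSlice.stem_unique {K : Set ℂ} {F₁ F₂ G₁ G₂ : ℂ → Quaternion ℝ}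
    {f : OmegaK K → Quaternion ℝ} (hF : InducesSlice K F₁ F₂ f) (hG : InducesSlice K G₁ G₂ f)
    {z : ℂ} (hz : z ∈ K) : F₁ z = G₁ z ∧ F₂ z = G₂ z := by
  obtain ⟨j, hj⟩ := exists_sq_eq_neg_one
  have hj' : (-j) ^ 2 = -1 := by rw [neg_sq, hj]
  have key : ∀ i : Quaternion ℝ, i ^ 2 = -1 → F₁ z + i * F₂ z = G₁ z + i * G₂ z := by
    intro i hi
    obtain ⟨q, hq⟩ := exists_point_over hz hi
    exact (hq _ _ _ hF).symm.trans (hq _ _ _ hG)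
  have h1 := key j hj
  have h2 := key (-j) hj'
  have h3 : F₁ z = G₁ z := by
    have : (2 : ℝ) • F₁ z = (2 : ℝ) • G₁ z := by
      rw [two_smul, two_smul]
      calc F₁ z + F₁ z = (F₁ z + j * F₂ z) + (F₁ z + -j * F₂ z) := by noncomm_ring
        _ = (G₁ z + j * G₂ z) + (G₁ z + -j * G₂ z) := by rw [h1, h2]
        _ = G₁ z + G₁ z := by noncomm_ring
    exact smul_right_injective _ two_ne_zero this
  rw [h3] at h1
  exact ⟨h3, mul_left_cancel₀ (ne_zero_of_sq_eq_neg_one hj) (add_left_cancel h1)⟩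

/-- Stem functions agreeing on `K` induce the same slice function. -/
theorem InducesSlice.eq_of_eqOn {K : Set ℂ} {F₁ F₂ G₁ G₂ : ℂ → Quaternion ℝ}
    {f g : OmegaK K → Quaternion ℝ} (hF : InducesSlice K F₁ F₂ f) (hG : InducesSlice K G₁ G₂ g)
    (h₁ : ∀ z ∈ K, F₁ z = G₁ z) (h₂ : ∀ z ∈ K, F₂ z = G₂ z) : f = g := by
  funext q
  obtain ⟨α, β, j, hj, hz, hq⟩ := q.2
  rw [hF q α β j hj hz hq, hG q α β j hj hz hq, h₁ _ hz, h₂ _ hz]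

/-- Every stem function induces a slice function. -/
theorem IsContStem.exists_inducesSlice {K : Set ℂ} {F₁ F₂ : ℂ → Quaternion ℝ}
    (hF : IsContStem K F₁ F₂) : ∃ f : OmegaK K → Quaternion ℝ, InducesSlice K F₁ F₂ f := by
  obtain ⟨-, -, h₁, h₂⟩ := hF
  choose α β j hj hz hq using fun q : OmegaK K => q.2
  refine ⟨fun q => F₁ (α q + β q * Complex.I) + j q * F₂ (α q + β q * Complex.I), ?_⟩
  intro q a b i hi hab hqi
  have hα := slice_coordinates (hj q) hi ((hq q).symm.trans hqi)
  have hz := hz q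
  beta_reduce
  rcases hα with ⟨eα, ⟨eβ, eb⟩ | ⟨eβ, ej⟩ | ⟨eβ, ej⟩⟩
  · have h0 : F₂ ((a : ℂ) + b * Complex.I) = 0 := by
      have h := h₂ _ hab
      have hc : (starRingEnd ℂ) ((a : ℂ) + b * Complex.I) = (a : ℂ) + b * Complex.I := by
        simp [eb]
      rw [hc] at h
      have h2 : (2 : ℝ) • F₂ ((a : ℂ) + b * Complex.I) = 0 := by
        rw [two_smul]
        exact add_eq_zero_iff_eq_neg.2 h
      exact (smul_eq_zero.1 h2).resolve_left two_ne_zero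
    rw [eα, eβ, ← eb, h0, mul_zero, mul_zero]
  · rw [eα, eβ, ej]
  · have hc : (α q : ℂ) + β q * Complex.I = (starRingEnd ℂ) ((a : ℂ) + b * Complex.I) := by
      simp [eα, eβ]
    rw [hc, h₁ _ hab, h₂ _ hab, ej, neg_mul_neg]

theorem IsContStem.add {K : Set ℂ} {F₁ F₂ G₁ G₂ : ℂ → Quaternion ℝ}
    (hF : IsContStem K F₁ F₂) (hG : IsContStem K G₁ G₂) :
    IsContStem K (fun z => F₁ z + G₁ z) (fun z => F₂ z + G₂ z) := by
  refine ⟨hF.1.add hG.1, hF.2.1.add hG.2.1, fun z hz => ?_, fun z hz => ?_⟩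
  · beta_reduce
    rw [hF.2.2.1 z hz, hG.2.2.1 z hz]
  · beta_reduce
    rw [hF.2.2.2 z hz, hG.2.2.2 z hz, neg_add]

theorem IsContStem.mul_const {K : Set ℂ} {F₁ F₂ : ℂ → Quaternion ℝ}
    (hF : IsContStem K F₁ F₂) (e : Quaternion ℝ) :
    IsContStem K (fun z => F₁ z * e) (fun z => F₂ z * e) := by
  refine ⟨hF.1.mul continuousOn_const, hF.2.1.mul continuousOn_const,
    fun z hz => ?_, fun z hz => ?_⟩
  · beta_reduce
    rw [hF.2.2.1 z hz]
  · beta_reduce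
    rw [hF.2.2.2 z hz, neg_mul]

theorem IsContStem.coe_comp {K : Set ℂ} {F₁ F₂ : ℂ → Quaternion ℝ}
    (hF : IsContStem K F₁ F₂) (c : Quaternion ℝ →ₗ[ℝ] ℝ) :
    IsContStem K (fun z => ((c (F₁ z) : ℝ) : Quaternion ℝ))
      (fun z => ((c (F₂ z) : ℝ) : Quaternion ℝ)) := by
  have hc : Continuous fun q : Quaternion ℝ => ((c q : ℝ) : Quaternion ℝ) :=
    Quaternion.continuous_coe.comp c.continuous_of_finiteDimensional
  refine ⟨hc.comp_continuousOn hF.1, hc.comp_continuousOn hF.2.1,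
    fun z hz => ?_, fun z hz => ?_⟩
  · beta_reduce
    rw [hF.2.2.1 z hz]
  · beta_reduce
    rw [hF.2.2.2 z hz, map_neg, Quaternion.coe_neg]

theorem InducesSlice.combination {K : Set ℂ} {A₀ B₀ A₁ B₁ A₂ B₂ A₃ B₃ : ℂ → Quaternion ℝ}
    {f₀ f₁ f₂ f₃ : OmegaK K → Quaternion ℝ} (h₀ : InducesSlice K A₀ B₀ f₀)
    (h₁ : InducesSlice K A₁ B₁ f₁) (h₂ : InducesSlice K A₂ B₂ f₂)
    (h₃ : InducesSlice K A₃ B₃ f₃) (j κ δ : Quaternion ℝ) :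
    InducesSlice K (fun z => A₀ z + A₁ z * j + A₂ z * κ + A₃ z * δ)
      (fun z => B₀ z + B₁ z * j + B₂ z * κ + B₃ z * δ)
      (fun q => f₀ q + f₁ q * j + f₂ q * κ + f₃ q * δ) := by
  intro q α β i hi hz hq
  beta_reduce
  rw [h₀ q α β i hi hz hq, h₁ q α β i hi hz hq, h₂ q α β i hi hz hq, h₃ q α β i hi hz hq]
  noncomm_ring

theorem IsContStem.combination {K : Set ℂ} {A₀ B₀ A₁ B₁ A₂ B₂ A₃ B₃ : ℂ → Quaternion ℝ}
    (h₀ : IsContStem K A₀ B₀) (h₁ : IsContStem K A₁ B₁) (h₂ : IsContStem K A₂ B₂)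
    (h₃ : IsContStem K A₃ B₃) (j κ δ : Quaternion ℝ) :
    IsContStem K (fun z => A₀ z + A₁ z * j + A₂ z * κ + A₃ z * δ)
      (fun z => B₀ z + B₁ z * j + B₂ z * κ + B₃ z * δ) :=
  ((h₀.add (h₁.mul_const j)).add (h₂.mul_const κ)).add (h₃.mul_const δ)

/-- An intrinsic slice function is real-valued iff its second stem component vanishes. -/
theorem InducesSlice.real_iff {K : Set ℂ} {A B : ℂ → Quaternion ℝ}
    {f : OmegaK K → Quaternion ℝ} (h : InducesSlice K A B f)
    (hA : ∀ z ∈ K, A z = ((A z).re : Quaternion ℝ))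
    (hB : ∀ z ∈ K, B z = ((B z).re : Quaternion ℝ)) :
    (∀ q, f q = ((f q).re : Quaternion ℝ)) ↔ ∀ z ∈ K, B z = 0 := by
  constructor
  · intro hf z hz
    obtain ⟨i, hi⟩ := exists_sq_eq_neg_one
    obtain ⟨q, hq⟩ := exists_point_over hz hi
    have a := hq _ _ _ h
    rw [hf, hA z hz, hB z hz] at a
    have a' : i * (((B z).re : ℝ) : Quaternion ℝ) =
        (((f q).re - (A z).re : ℝ) : Quaternion ℝ) := by
      rw [Quaternion.coe_sub, a, add_sub_cancel_left]
    have hre := congrArg (fun q : Quaternion ℝ => q.re) a'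
    simp only [Quaternion.mul_coe_eq_smul, Quaternion.re_smul, Quaternion.re_coe,
      re_eq_zero_of_sq_eq_neg_one hi, smul_zero] at hre
    rw [← hre, Quaternion.coe_zero] at a'
    rw [hB z hz]
    exact (mul_eq_zero.1 a').resolve_left (ne_zero_of_sq_eq_neg_one hi)
  · intro hB0 q
    obtain ⟨α, β, i, hi, hz, hq⟩ := q.2
    rw [h q α β i hi hz hq, hB0 _ hz, mul_zero, add_zero]
    exact hA _ hz

/-- An intrinsic slice function vanishes iff its stem components do. -/
theorem InducesSlice.zero_iff {K : Set ℂ} {A B : ℂ → Quaternion ℝ}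
    {f : OmegaK K → Quaternion ℝ} (h : InducesSlice K A B f) :
    (∀ q, f q = 0) ↔ ∀ z ∈ K, A z = 0 ∧ B z = 0 := by
  constructor
  · intro hf z hz
    have h0 : InducesSlice K (fun _ => 0) (fun _ => 0) f := by
      intro q _ _ _ _ _ _
      rw [hf q, mul_zero, add_zero]
    exact h.stem_unique h0 hz
  · intro h0 q
    obtain ⟨α, β, i, hi, hz, hq⟩ := q.2
    rw [h q α β i hi hz hq, (h0 _ hz).1, (h0 _ hz).2, mul_zero, add_zero]

/-- Real-valued coefficients with respect to a linearly independent family are unique. -/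
theorem coefficients_unique {j κ δ : Quaternion ℝ}
    (hindep : LinearIndependent ℝ ![(1 : Quaternion ℝ), j, κ, δ])
    {a₀ a₁ a₂ a₃ b₀ b₁ b₂ b₃ : Quaternion ℝ}
    (ha₀ : a₀ = (a₀.re : Quaternion ℝ)) (ha₁ : a₁ = (a₁.re : Quaternion ℝ))
    (ha₂ : a₂ = (a₂.re : Quaternion ℝ)) (ha₃ : a₃ = (a₃.re : Quaternion ℝ))
    (hb₀ : b₀ = (b₀.re : Quaternion ℝ)) (hb₁ : b₁ = (b₁.re : Quaternion ℝ))
    (hb₂ : b₂ = (b₂.re : Quaternion ℝ)) (hb₃ : b₃ = (b₃.re : Quaternion ℝ))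
    (h : a₀ + a₁ * j + a₂ * κ + a₃ * δ = b₀ + b₁ * j + b₂ * κ + b₃ * δ) :
    a₀ = b₀ ∧ a₁ = b₁ ∧ a₂ = b₂ ∧ a₃ = b₃ := by
  have h0 := Fintype.linearIndependent_iff.1 hindep
    ![a₀.re - b₀.re, a₁.re - b₁.re, a₂.re - b₂.re, a₃.re - b₃.re] (by
      simp only [Fin.sum_univ_four, Matrix.cons_val]
      simp only [← Quaternion.coe_mul_eq_smul, Quaternion.coe_sub, ← ha₀, ← ha₁, ← ha₂, ← ha₃,
        ← hb₀, ← hb₁, ← hb₂, ← hb₃]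
      rw [← sub_eq_zero] at h
      rw [← h]
      noncomm_ring)
  have e₀ := h0 0
  have e₁ := h0 1
  have e₂ := h0 2
  have e₃ := h0 3
  simp only [Matrix.cons_val, sub_eq_zero] at e₀ e₁ e₂ e₃
  rw [ha₀, ha₁, ha₂, ha₃, hb₀, hb₁, hb₂, hb₃, e₀, e₁, e₂, e₃]
  simp only [and_self]

/-- Coordinate functionals with respect to a real basis of `ℍ`. -/
theorem exists_coordinates {j κ δ : Quaternion ℝ}
    (hindep : LinearIndependent ℝ ![(1 : Quaternion ℝ), j, κ, δ])
    (hspan : Submodule.span ℝ {(1 : Quaternion ℝ), j, κ, δ} = ⊤) :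
    ∃ c : Fin 4 → Quaternion ℝ →ₗ[ℝ] ℝ, ∀ q : Quaternion ℝ,
      (c 0 q : Quaternion ℝ) + (c 1 q : Quaternion ℝ) * j + (c 2 q : Quaternion ℝ) * κ
        + (c 3 q : Quaternion ℝ) * δ = q := by
  have hr : Set.range ![(1 : Quaternion ℝ), j, κ, δ] = {(1 : Quaternion ℝ), j, κ, δ} := by
    simp only [Matrix.range_cons, Matrix.range_empty, Set.union_empty, Set.singleton_union]
  let b := Module.Basis.mk hindep (by rw [hr, hspan])
  refine ⟨b.coord, fun q => ?_⟩
  have h := b.sum_repr q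
  simp only [Fin.sum_univ_four, b, Module.Basis.mk_apply, Matrix.cons_val,
    ← Quaternion.coe_mul_eq_smul, mul_one] at h
  exact h

/-- Let `K ⊆ ℂ` be nonempty and conjugation-invariant, and `{1, j, κ, δ}`
a real basis of `ℍ`. Then `(f₀, f₁, f₂, f₃) ↦ f₀ + f₁·j + f₂·κ + f₃·δ` is a bijection from
quadruples of continuous `ℍ`-intrinsic slice functions on `Ω_K` onto the continuous slice
functions on `Ω_K`. Moreover: (a) if `j ∈ 𝕊`, the resulting `f` is a `ℂ_j`-slice function
iff `f₂ = f₃ = 0`; (b) `f` is circular iff `f₀, f₁, f₂, f₃` are all real-valued. -/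
theorem statement15 (K : Set ℂ) (hK : K.Nonempty)
    (hKconj : ∀ z ∈ K, (starRingEnd ℂ) z ∈ K)
    (j κ δ : Quaternion ℝ)
    (hindep : LinearIndependent ℝ ![(1 : Quaternion ℝ), j, κ, δ])
    (hspan : Submodule.span ℝ {(1 : Quaternion ℝ), j, κ, δ} = ⊤) :
    Set.BijOn
      (fun p : (OmegaK K → Quaternion ℝ) × (OmegaK K → Quaternion ℝ) ×
          (OmegaK K → Quaternion ℝ) × (OmegaK K → Quaternion ℝ) =>
        fun q : OmegaK K => p.1 q + p.2.1 q * j + p.2.2.1 q * κ + p.2.2.2 q * δ)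
      {p | p.1 ∈ SliceContIntrinsic K ∧ p.2.1 ∈ SliceContIntrinsic K ∧
        p.2.2.1 ∈ SliceContIntrinsic K ∧ p.2.2.2 ∈ SliceContIntrinsic K}
      (SliceCont K) ∧
    (∀ f₀ f₁ f₂ f₃ : OmegaK K → Quaternion ℝ,
      f₀ ∈ SliceContIntrinsic K → f₁ ∈ SliceContIntrinsic K →
      f₂ ∈ SliceContIntrinsic K → f₃ ∈ SliceContIntrinsic K →
      (j ^ 2 = -1 →
        ((fun q => f₀ q + f₁ q * j + f₂ q * κ + f₃ q * δ) ∈ SliceContCj K j ↔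
          (∀ q, f₂ q = 0) ∧ (∀ q, f₃ q = 0))) ∧
      ((fun q => f₀ q + f₁ q * j + f₂ q * κ + f₃ q * δ) ∈ SliceContCircular K ↔
        ((∀ q, f₀ q = ((f₀ q).re : Quaternion ℝ)) ∧ (∀ q, f₁ q = ((f₁ q).re : Quaternion ℝ)) ∧
         (∀ q, f₂ q = ((f₂ q).re : Quaternion ℝ)) ∧
         (∀ q, f₃ q = ((f₃ q).re : Quaternion ℝ))))) := by
  refine ⟨⟨?_, ?_, ?_⟩, ?_⟩
  · rintro ⟨f₀, f₁, f₂, f₃⟩ ⟨⟨A₀, B₀, s₀, -, -, i₀⟩, ⟨A₁, B₁, s₁, -, -, i₁⟩,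
      ⟨A₂, B₂, s₂, -, -, i₂⟩, ⟨A₃, B₃, s₃, -, -, i₃⟩⟩
    exact ⟨_, _, s₀.combination s₁ s₂ s₃ j κ δ, i₀.combination i₁ i₂ i₃ j κ δ⟩
  · rintro ⟨f₀, f₁, f₂, f₃⟩ ⟨⟨A₀, B₀, -, a₀, b₀, i₀⟩, ⟨A₁, B₁, -, a₁, b₁, i₁⟩,
      ⟨A₂, B₂, -, a₂, b₂, i₂⟩, ⟨A₃, B₃, -, a₃, b₃, i₃⟩⟩
      ⟨g₀, g₁, g₂, g₃⟩ ⟨⟨A₀', B₀', -, a₀', b₀', i₀'⟩, ⟨A₁', B₁', -, a₁', b₁', i₁'⟩,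
      ⟨A₂', B₂', -, a₂', b₂', i₂'⟩, ⟨A₃', B₃', -, a₃', b₃', i₃'⟩⟩ hfg
    have hf := i₀.combination i₁ i₂ i₃ j κ δ
    have hg := i₀'.combination i₁' i₂' i₃' j κ δ
    dsimp only at hfg i₀ i₁ i₂ i₃ i₀' i₁' i₂' i₃' hf hg
    rw [← hfg] at hg
    have hA := fun z hz => coefficients_unique hindep (a₀ z hz) (a₁ z hz) (a₂ z hz) (a₃ z hz)
      (a₀' z hz) (a₁' z hz) (a₂' z hz) (a₃' z hz) (hf.stem_unique hg hz).1
    have hB := fun z hz => coefficients_unique hindep (b₀ z hz) (b₁ z hz) (b₂ z hz) (b₃ z hz)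
      (b₀' z hz) (b₁' z hz) (b₂' z hz) (b₃' z hz) (hf.stem_unique hg hz).2
    rw [i₀.eq_of_eqOn i₀' (fun z hz => (hA z hz).1) (fun z hz => (hB z hz).1),
      i₁.eq_of_eqOn i₁' (fun z hz => (hA z hz).2.1) (fun z hz => (hB z hz).2.1),
      i₂.eq_of_eqOn i₂' (fun z hz => (hA z hz).2.2.1) (fun z hz => (hB z hz).2.2.1),
      i₃.eq_of_eqOn i₃' (fun z hz => (hA z hz).2.2.2) (fun z hz => (hB z hz).2.2.2)]
  · rintro f ⟨F₁, F₂, hs, hi⟩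
    obtain ⟨c, hc⟩ := exists_coordinates hindep hspan
    choose g hg using fun n => (hs.coe_comp (c n)).exists_inducesSlice
    have hmem : ∀ n, g n ∈ SliceContIntrinsic K := fun n =>
      ⟨_, _, hs.coe_comp (c n), fun z _ => by rw [Quaternion.re_coe],
        fun z _ => by rw [Quaternion.re_coe], hg n⟩
    exact ⟨(g 0, g 1, g 2, g 3), ⟨hmem 0, hmem 1, hmem 2, hmem 3⟩,
      ((hg 0).combination (hg 1) (hg 2) (hg 3) j κ δ).eq_of_eqOn hi
        (fun z _ => hc (F₁ z)) (fun z _ => hc (F₂ z))⟩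
  · rintro f₀ f₁ f₂ f₃ ⟨A₀, B₀, s₀, a₀, b₀, i₀⟩ ⟨A₁, B₁, s₁, a₁, b₁, i₁⟩
      ⟨A₂, B₂, s₂, a₂, b₂, i₂⟩ ⟨A₃, B₃, s₃, a₃, b₃, i₃⟩
    have hs := s₀.combination s₁ s₂ s₃ j κ δ
    have hi := i₀.combination i₁ i₂ i₃ j κ δ
    have h0 : (0 : Quaternion ℝ) = ((0 : Quaternion ℝ).re : Quaternion ℝ) := by
      rw [Quaternion.re_zero, Quaternion.coe_zero]
    refine ⟨fun _ => ?_, ?_⟩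
    · rw [i₂.zero_iff, i₃.zero_iff]
      constructor
      · rintro ⟨F₁, F₂, -, hF₁, hF₂, hF⟩
        have hA : ∀ z ∈ K, A₂ z = 0 ∧ A₃ z = 0 := fun z hz => by
          obtain ⟨a, b, hab⟩ := hF₁ z hz
          refine (coefficients_unique hindep (a₀ z hz) (a₁ z hz) (a₂ z hz) (a₃ z hz)
            (b₀ := (a : Quaternion ℝ)) (b₁ := (b : Quaternion ℝ)) (by simp) (by simp) h0 h0
            ?_).2.2
          rw [(hi.stem_unique hF hz).1, hab, Quaternion.coe_mul_eq_smul, zero_mul, zero_mul,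
            add_zero, add_zero]
        have hB : ∀ z ∈ K, B₂ z = 0 ∧ B₃ z = 0 := fun z hz => by
          obtain ⟨a, b, hab⟩ := hF₂ z hz
          refine (coefficients_unique hindep (b₀ z hz) (b₁ z hz) (b₂ z hz) (b₃ z hz)
            (b₀ := (a : Quaternion ℝ)) (b₁ := (b : Quaternion ℝ)) (by simp) (by simp) h0 h0
            ?_).2.2
          rw [(hi.stem_unique hF hz).2, hab, Quaternion.coe_mul_eq_smul, zero_mul, zero_mul,
            add_zero, add_zero]
        exact ⟨fun z hz => ⟨(hA z hz).1, (hB z hz).1⟩, fun z hz => ⟨(hA z hz).2, (hB z hz).2⟩⟩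
      · rintro ⟨h2, h3⟩
        refine ⟨_, _, hs, fun z hz => ⟨(A₀ z).re, (A₁ z).re, ?_⟩,
          fun z hz => ⟨(B₀ z).re, (B₁ z).re, ?_⟩, hi⟩
        · rw [(h2 z hz).1, (h3 z hz).1, ← Quaternion.coe_mul_eq_smul, ← a₀ z hz, ← a₁ z hz,
            zero_mul, zero_mul, add_zero, add_zero]
        · rw [(h2 z hz).2, (h3 z hz).2, ← Quaternion.coe_mul_eq_smul, ← b₀ z hz, ← b₁ z hz,
            zero_mul, zero_mul, add_zero, add_zero]
    · rw [i₀.real_iff a₀ b₀, i₁.real_iff a₁ b₁, i₂.real_iff a₂ b₂, i₃.real_iff a₃ b₃]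
      constructor
      · rintro ⟨F₁, F₂, -, hF₂, hF⟩
        have hB := fun z hz => coefficients_unique hindep (b₀ z hz) (b₁ z hz) (b₂ z hz)
          (b₃ z hz) h0 h0 h0 h0 (by
            rw [(hi.stem_unique hF hz).2, hF₂ z hz]
            simp only [zero_mul, add_zero])
        exact ⟨fun z hz => (hB z hz).1, fun z hz => (hB z hz).2.1,
          fun z hz => (hB z hz).2.2.1, fun z hz => (hB z hz).2.2.2⟩
      · rintro ⟨e₀, e₁, e₂, e₃⟩
        refine ⟨_, _, hs, fun z hz => ?_, hi⟩
        simp only [e₀ z hz, e₁ z hz, e₂ z hz, e₃ z hz, zero_mul, add_zero]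
end

section
/- (Weierstrass-type approximation for ℍ-intrinsic slice functions) Let K ⊆ ℂ be nonempty, compact and invariant under complex conjugation, and let f = 𝓘(F₁ + iF₂) be a continuous ℍ-intrinsic slice function on Ω_K (F₁, F₂ : K → ℝ continuous). Then for every ε > 0 there exist real polynomials Q₁, Q₂ ∈ ℝ[X,Y] with Q₁(X, −Y) = Q₁(X, Y) and Q₂(X, −Y) = −Q₂(X, Y) such that |f(α + jβ) − (Q₁(α, β) + j·Q₂(α, β))| < ε for all α, β ∈ ℝ and j ∈ 𝕊 with α + iβ ∈ K. In other words, the polynomial ℍ-intrinsic slice functions are dense in the continuous ℍ-intrinsic slice functions on Ω_K with respect to the supremum norm. -/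
/-- Bivariate real polynomials in `(Re z, Im z)` are uniformly dense in the continuous real
functions on a compact subset of `ℂ`. -/
theorem exists_mvPolynomial_re_im_near {K : Set ℂ} (hK : IsCompact K) {F : ℂ → ℝ}
    (hF : ContinuousOn F K) {ε : ℝ} (hε : 0 < ε) :
    ∃ P : MvPolynomial (Fin 2) ℝ, ∀ z ∈ K, |MvPolynomial.eval ![z.re, z.im] P - F z| < ε := by
  have : CompactSpace K := isCompact_iff_compactSpace.mp hK
  let re : C(K, ℝ) := ⟨fun z ↦ z.1.re, by fun_prop⟩
  let im : C(K, ℝ) := ⟨fun z ↦ z.1.im, by fun_prop⟩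
  let φ : MvPolynomial (Fin 2) ℝ →ₐ[ℝ] C(K, ℝ) := MvPolynomial.aeval ![re, im]
  have hφ (P : MvPolynomial (Fin 2) ℝ) (z : K) :
      φ P z = MvPolynomial.eval ![z.1.re, z.1.im] P := by
    induction P using MvPolynomial.induction_on with
    | C a => simp [φ]
    | add p q hp hq => simp [hp, hq]
    | mul_X p i hp => fin_cases i <;> simp [hp, φ, re, im]
  have hsep : φ.range.SeparatesPoints := by
    intro x y hxy
    by_cases h : x.1.re = y.1.re
    · refine ⟨im, ⟨im, ⟨MvPolynomial.X 1, by simp [φ]⟩, rfl⟩, fun h' ↦ hxy ?_⟩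
      exact Subtype.ext (Complex.ext h h')
    · exact ⟨re, ⟨re, ⟨MvPolynomial.X 0, by simp [φ]⟩, rfl⟩, h⟩
  obtain ⟨⟨_, P, rfl⟩, hP⟩ :=
    ContinuousMap.exists_mem_subalgebra_near_continuous_of_separatesPoints φ.range hsep
      (K.domRestrict F) hF.domRestrict ε hε
  refine ⟨P, fun z hz ↦ ?_⟩
  rw [← hφ P ⟨z, hz⟩]
  exact hP ⟨z, hz⟩

/-- If `F` satisfies `F (conj z) = s * F z` with `s = 1` or `s = -1`, then the approximating
polynomials can be chosen with the same parity in the second variable. -/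
theorem exists_mvPolynomial_re_im_near_of_parity {K : Set ℂ} (hK : IsCompact K)
    (hKconj : ∀ z ∈ K, (starRingEnd ℂ) z ∈ K) {F : ℂ → ℝ} (hF : ContinuousOn F K)
    {s : ℝ} (hs : s = 1 ∨ s = -1) (hFs : ∀ z ∈ K, F ((starRingEnd ℂ) z) = s * F z)
    {ε : ℝ} (hε : 0 < ε) :
    ∃ Q : MvPolynomial (Fin 2) ℝ,
      (∀ α β : ℝ, MvPolynomial.eval ![α, -β] Q = s * MvPolynomial.eval ![α, β] Q) ∧
      ∀ z ∈ K, |MvPolynomial.eval ![z.re, z.im] Q - F z| < ε := by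
  obtain ⟨P, hP⟩ := exists_mvPolynomial_re_im_near hK hF hε
  let Q : MvPolynomial (Fin 2) ℝ := MvPolynomial.C (1 / 2) *
    (P + MvPolynomial.C s * MvPolynomial.bind₁ ![MvPolynomial.X 0, -MvPolynomial.X 1] P)
  have hQ (α β : ℝ) : MvPolynomial.eval ![α, β] Q =
      1 / 2 * (MvPolynomial.eval ![α, β] P + s * MvPolynomial.eval ![α, -β] P) := by
    have hcomp : (fun i ↦ MvPolynomial.eval ![α, β]
        ((![MvPolynomial.X 0, -MvPolynomial.X 1] : Fin 2 → MvPolynomial (Fin 2) ℝ) i)) =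
        ![α, -β] := by
      ext i
      fin_cases i <;> simp
    have hbind : MvPolynomial.eval ![α, β]
        (MvPolynomial.bind₁ ![MvPolynomial.X 0, -MvPolynomial.X 1] P) =
        MvPolynomial.eval ![α, -β] P := by
      rw [← hcomp]
      exact MvPolynomial.eval₂Hom_bind₁ (RingHom.id ℝ) _ _ P
    simp only [Q, map_mul, map_add, MvPolynomial.eval_C, hbind]
  refine ⟨Q, fun α β ↦ ?_, fun z hz ↦ ?_⟩
  · rw [hQ, hQ, neg_neg]
    rcases hs with rfl | rfl <;> ring
  · have h₁ := abs_lt.mp (hP z hz)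
    have h₂ := abs_lt.mp (hP _ (hKconj z hz))
    rw [hFs z hz, Complex.conj_re, Complex.conj_im] at h₂
    rw [hQ, abs_lt]
    rcases hs with rfl | rfl <;> constructor <;> linarith [h₁.1, h₁.2, h₂.1, h₂.2]

theorem norm_eq_one_of_sq_eq_neg_one {A : Type*} [NormedDivisionRing A] {j : A}
    (hj : j ^ 2 = -1) : ‖j‖ = 1 := by
  rw [← sq_eq_sq₀ (norm_nonneg j) zero_le_one, ← norm_pow, hj, norm_neg, norm_one, one_pow]


/-- Weierstrass-type approximation for `ℍ`-intrinsic slice functions.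
Let `K ⊆ ℂ` be nonempty, compact and conjugation-invariant and let `f` be the continuous
`ℍ`-intrinsic slice function on `Ω_K` induced by the continuous real-valued stem components
`F₁, F₂ : K → ℝ`. Then for every `ε > 0` there are real polynomials `Q₁, Q₂ ∈ ℝ[X,Y]` with
`Q₁(X, −Y) = Q₁(X, Y)` and `Q₂(X, −Y) = −Q₂(X, Y)` such that
`|f(α + jβ) − (Q₁(α,β) + j·Q₂(α,β))| < ε` for all `α, β ∈ ℝ` and `j ∈ 𝕊` with
`α + iβ ∈ K`: the polynomial `ℍ`-intrinsic slice functions are dense in the continuous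
`ℍ`-intrinsic slice functions for the supremum norm. -/
theorem statement16 (K : Set ℂ) (hK : K.Nonempty) (hKcpt : IsCompact K)
    (hKconj : ∀ z ∈ K, (starRingEnd ℂ) z ∈ K)
    (F₁ F₂ : ℂ → ℝ)
    (hF₁c : ContinuousOn F₁ K) (hF₂c : ContinuousOn F₂ K)
    (hF₁ : ∀ z ∈ K, F₁ ((starRingEnd ℂ) z) = F₁ z)
    (hF₂ : ∀ z ∈ K, F₂ ((starRingEnd ℂ) z) = -F₂ z)
    (f : Quaternion ℝ → Quaternion ℝ)
    (hf : ∀ (α β : ℝ) (j : Quaternion ℝ), j ^ 2 = -1 → (α : ℂ) + β * Complex.I ∈ K →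
      f ((α : Quaternion ℝ) + β • j) =
        ((F₁ ((α : ℂ) + β * Complex.I) : ℝ) : Quaternion ℝ)
          + F₂ ((α : ℂ) + β * Complex.I) • j) :
    ∀ ε : ℝ, 0 < ε → ∃ Q₁ Q₂ : MvPolynomial (Fin 2) ℝ,
      (∀ α β : ℝ, MvPolynomial.eval ![α, -β] Q₁ = MvPolynomial.eval ![α, β] Q₁) ∧
      (∀ α β : ℝ, MvPolynomial.eval ![α, -β] Q₂ = -MvPolynomial.eval ![α, β] Q₂) ∧
      (∀ (α β : ℝ) (j : Quaternion ℝ), j ^ 2 = -1 → (α : ℂ) + β * Complex.I ∈ K →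
        ‖f ((α : Quaternion ℝ) + β • j) -
          (((MvPolynomial.eval ![α, β] Q₁ : ℝ) : Quaternion ℝ)
            + MvPolynomial.eval ![α, β] Q₂ • j)‖ < ε) := by
  intro ε hε
  obtain ⟨Q₁, hQ₁, hQ₁F⟩ := exists_mvPolynomial_re_im_near_of_parity hKcpt hKconj hF₁c
    (Or.inl rfl) (fun z hz ↦ by rw [hF₁ z hz, one_mul]) (half_pos hε)
  obtain ⟨Q₂, hQ₂, hQ₂F⟩ := exists_mvPolynomial_re_im_near_of_parity hKcpt hKconj hF₂c
    (Or.inr rfl) (fun z hz ↦ by rw [hF₂ z hz, neg_one_mul]) (half_pos hε)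
  refine ⟨Q₁, Q₂, fun α β ↦ by rw [hQ₁, one_mul], fun α β ↦ by rw [hQ₂, neg_one_mul],
    fun α β j hj hz ↦ ?_⟩
  have h₁ := hQ₁F _ hz
  have h₂ := hQ₂F _ hz
  rw [hf α β j hj hz, add_sub_add_comm, ← sub_smul, ← Quaternion.coe_sub]
  simp only [Complex.add_re, Complex.add_im, Complex.re_ofReal_mul, Complex.im_ofReal_mul,
    Complex.ofReal_re, Complex.ofReal_im, Complex.I_re, Complex.I_im, mul_zero, mul_one,
    add_zero, zero_add] at h₁ h₂
  refine (norm_add_le _ _).trans_lt ?_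
  rw [Quaternion.norm_coe, norm_smul, norm_eq_one_of_sq_eq_neg_one hj, mul_one,
    Real.norm_eq_abs, Real.norm_eq_abs, abs_sub_comm, abs_sub_comm (F₂ _)]
  linarith
end

section
/- (Submultiplicativity of the norm of ℍ_ℂ) For all quaternions q, p, q', p': ‖(qq' − pp') + i(qp' + pq')‖ ≤ ‖q + ip‖ · ‖q' + ip'‖, where ‖x + iy‖ = (|x|² + |y|² + 2|Im(y x̄)|)^{1/2}. That is, the norm ‖·‖ on the complexified quaternions ℍ_ℂ is submultiplicative with respect to the product (q + ip)(q' + ip') = (qq' − pp') + i(qp' + pq'). -/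
open Quaternion in
/-- Polarization of the norm of `q + μ * p` for a quaternion `μ` of norm one. -/
theorem Quaternion.norm_add_mul_sq {μ : ℍ[ℝ]} (hμ : ‖μ‖ = 1) (q p : ℍ[ℝ]) :
    ‖q + μ * p‖ ^ 2 = ‖q‖ ^ 2 + ‖p‖ ^ 2 + 2 * (μ * (p * star q)).re := by
  rw [@norm_add_sq_real, norm_mul, hμ, one_mul, real_inner_comm, Quaternion.inner_def, mul_assoc]
  ring

open Quaternion in
theorem Quaternion.re_mul_eq_re_mul_im {μ : ℍ[ℝ]} (hμ : μ.re = 0) (v : ℍ[ℝ]) :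
    (μ * v).re = (μ * v.im).re := by
  simp [hμ]

open Quaternion in
theorem Quaternion.re_le_norm (v : ℍ[ℝ]) : v.re ≤ ‖v‖ := by
  refine (abs_le_of_sq_le_sq' ?_ (norm_nonneg v)).2
  rw [sq ‖v‖, ← Quaternion.normSq_eq_norm_mul_self, Quaternion.normSq_def']
  nlinarith [sq_nonneg v.imI, sq_nonneg v.imJ, sq_nonneg v.imK]

open Quaternion in
/-- A purely imaginary quaternion `μ` of norm one gives a lower bound `‖q + μ * p‖` for the norm
of `q + ip` in the complexified quaternions. -/
theorem Quaternion.norm_add_mul_sq_le {μ : ℍ[ℝ]} (hμ : ‖μ‖ = 1) (hre : μ.re = 0) (q p : ℍ[ℝ]) :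
    ‖q + μ * p‖ ^ 2 ≤ ‖q‖ ^ 2 + ‖p‖ ^ 2 + 2 * ‖(p * star q).im‖ := by
  rw [Quaternion.norm_add_mul_sq hμ, Quaternion.re_mul_eq_re_mul_im hre]
  have h := Quaternion.re_le_norm (μ * (p * star q).im)
  rw [norm_mul, hμ, one_mul] at h
  linarith

open Quaternion in
/-- The norm of `q + ip` in the complexified quaternions is attained as `‖q + μ * p‖` for some
purely imaginary quaternion `μ` of norm one. -/
theorem Quaternion.exists_norm_add_mul_sq_eq (q p : ℍ[ℝ]) :
    ∃ μ : ℍ[ℝ], ‖μ‖ = 1 ∧ μ.re = 0 ∧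
      ‖q + μ * p‖ ^ 2 = ‖q‖ ^ 2 + ‖p‖ ^ 2 + 2 * ‖(p * star q).im‖ := by
  suffices h : ∀ v : ℍ[ℝ], ∃ μ : ℍ[ℝ], ‖μ‖ = 1 ∧ μ.re = 0 ∧ (μ * v).re = ‖v.im‖ by
    obtain ⟨μ, h1, h2, h3⟩ := h (p * star q)
    exact ⟨μ, h1, h2, by rw [Quaternion.norm_add_mul_sq h1, h3]⟩
  intro v
  by_cases hv : v.im = 0
  · obtain ⟨μ, hμ, hre⟩ : ∃ μ : ℍ[ℝ], normSq μ = 1 ∧ μ.re = 0 :=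
      ⟨⟨0, 1, 0, 0⟩, (Quaternion.normSq_def' _).trans (by norm_num), rfl⟩
    rw [Quaternion.normSq_eq_norm_mul_self, ← sq,
      pow_eq_one_iff_of_nonneg (norm_nonneg μ) two_ne_zero] at hμ
    exact ⟨μ, hμ, hre, by rw [Quaternion.re_mul_eq_re_mul_im hre, hv]; simp⟩
  · have hn : ‖v.im‖ ≠ 0 := norm_ne_zero_iff.mpr hv
    have hre : (-(‖v.im‖⁻¹ • v.im)).re = 0 := by simp
    refine ⟨-(‖v.im‖⁻¹ • v.im), ?_, hre, ?_⟩
    · rw [norm_neg, norm_smul, norm_inv, norm_norm, inv_mul_cancel₀ hn]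
    · have hsq : (v.im * v.im).re = -(‖v.im‖ * ‖v.im‖) := by
        rw [← Quaternion.normSq_eq_norm_mul_self, Quaternion.normSq_def']
        simp
        ring
      rw [Quaternion.re_mul_eq_re_mul_im hre, neg_mul, smul_mul_assoc, Quaternion.re_neg,
        Quaternion.re_smul, hsq, smul_eq_mul]
      field_simp

theorem Quaternion.re_mul_comm (a b : Quaternion ℝ) : (a * b).re = (b * a).re := by
  simp only [Quaternion.re_mul]
  ring

/-- submultiplicativity of the `C*`-norm of `ℍ_ℂ`. For all quaternions
`q, p, q', p'`: `‖(qq' − pp') + i(qp' + pq')‖ ≤ ‖q + ip‖ · ‖q' + ip'‖`, where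
`‖x + iy‖ = (|x|² + |y|² + 2|Im(y x̄)|)^{1/2}`. -/
theorem statement18 (q p q' p' : Quaternion ℝ) :
    Real.sqrt (‖q * q' - p * p'‖ ^ 2 + ‖q * p' + p * q'‖ ^ 2
        + 2 * ‖((q * p' + p * q') * star (q * q' - p * p')).im‖)
      ≤ Real.sqrt (‖q‖ ^ 2 + ‖p‖ ^ 2 + 2 * ‖(p * star q).im‖)
        * Real.sqrt (‖q'‖ ^ 2 + ‖p'‖ ^ 2 + 2 * ‖(p' * star q').im‖) := by
  rw [← Real.sqrt_mul (by positivity)]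
  apply Real.sqrt_le_sqrt
  obtain ⟨μ, hμ, hre, h⟩ :=
    Quaternion.exists_norm_add_mul_sq_eq (q * q' - p * p') (q * p' + p * q')
  rw [← h]
  have hsq : μ * μ = -1 := by
    have hs : star μ = -μ := Quaternion.star_eq_neg.mpr hre
    have := Quaternion.self_mul_star μ
    rw [hs, Quaternion.normSq_eq_norm_mul_self, hμ, mul_neg] at this
    rw [← neg_eq_iff_eq_neg, this]
    simp
  have hfac : q * q' - p * p' + μ * (q * p' + p * q')
      = (q + μ * p) * q' + μ * (q + μ * p) * p' := by
    have : μ * (μ * p) = -p := by rw [← mul_assoc, hsq, neg_one_mul]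
    rw [mul_add μ q, this]
    noncomm_ring
  rw [hfac]
  have hle := Quaternion.norm_add_mul_sq_le hμ hre q p
  generalize q + μ * p = a at hle ⊢
  rcases eq_or_ne a 0 with rfl | ha
  · simp only [zero_mul, mul_zero, add_zero, norm_zero, zero_pow two_ne_zero]
    positivity
  · have hν : ‖a⁻¹ * μ * a‖ = 1 := by
      rw [norm_mul, norm_mul, hμ, norm_inv, mul_one, inv_mul_cancel₀ (norm_ne_zero_iff.mpr ha)]
    have hνre : (a⁻¹ * μ * a).re = 0 := by
      rw [Quaternion.re_mul_comm, ← mul_assoc, mul_inv_cancel₀ ha, one_mul, hre]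
    have hconj : a * q' + μ * a * p' = a * (q' + a⁻¹ * μ * a * p') := by
      simp only [mul_add, ← mul_assoc, mul_inv_cancel₀ ha, one_mul]
    rw [hconj, norm_mul, mul_pow]
    exact mul_le_mul hle (Quaternion.norm_add_mul_sq_le hν hνre q' p') (by positivity)
      (by positivity)
end

section
/- (C*-identity for the norm of ℍ_ℂ) For every element w = q + ip of the complexified quaternions, ‖w* w‖ = ‖w‖², i.e. ‖(q̄q + p̄p) + i(q̄p − p̄q)‖ = ‖q + ip‖², where w* = q̄ − i p̄ and ‖x + iy‖ = (|x|² + |y|² + 2|Im(y x̄)|)^{1/2}. -/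
open Quaternion in
/-- The imaginary parts of `p q̄` and `q̄ p` have the same norm, since the two products share their
real part and their norm. -/
theorem Quaternion.norm_star_mul_sub_star_mul (q p : ℍ[ℝ]) :
    ‖star q * p - star p * q‖ = 2 * ‖(p * star q).im‖ := by
  rw [← sq_eq_sq₀ (norm_nonneg _) (by positivity), mul_pow]
  simp only [sq ‖_‖, ← Quaternion.normSq_eq_norm_mul_self, Quaternion.normSq_def']
  simp
  ring

open Quaternion in
theorem Quaternion.star_mul_self_add_star_mul_self (q p : ℍ[ℝ]) :
    star q * q + star p * p = ((‖q‖ ^ 2 + ‖p‖ ^ 2 : ℝ) : ℍ[ℝ]) := by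
  simp only [Quaternion.star_mul_self, Quaternion.normSq_eq_norm_mul_self, sq, Quaternion.coe_add]

open Quaternion in
theorem Quaternion.im_star_mul_sub_star_mul (q p : ℍ[ℝ]) :
    (star q * p - star p * q).im = star q * p - star p * q := by
  ext <;> simp
  ring


/-- `C*`-identity for the norm of `ℍ_ℂ`. For every `w = q + ip` in the
complexified quaternions, `‖w* w‖ = ‖w‖²`, i.e.
`‖(q̄q + p̄p) + i(q̄p − p̄q)‖ = ‖q + ip‖²`, where `w* = q̄ − i p̄` and
`‖x + iy‖ = (|x|² + |y|² + 2|Im(y x̄)|)^{1/2}`. -/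
theorem statement19 (q p : Quaternion ℝ) :
    Real.sqrt (‖star q * q + star p * p‖ ^ 2 + ‖star q * p - star p * q‖ ^ 2
        + 2 * ‖((star q * p - star p * q) * star (star q * q + star p * p)).im‖)
      = (Real.sqrt (‖q‖ ^ 2 + ‖p‖ ^ 2 + 2 * ‖(p * star q).im‖)) ^ 2 := by
  have hN : 0 ≤ ‖q‖ ^ 2 + ‖p‖ ^ 2 := by positivity
  have him : ((star q * p - star p * q) * star (star q * q + star p * p)).im
      = (‖q‖ ^ 2 + ‖p‖ ^ 2) • (star q * p - star p * q) := by
    rw [Quaternion.star_mul_self_add_star_mul_self, Quaternion.star_coe,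
      Quaternion.mul_coe_eq_smul, Quaternion.im_smul, Quaternion.im_star_mul_sub_star_mul]
  rw [him, norm_smul, Real.norm_of_nonneg hN, Quaternion.star_mul_self_add_star_mul_self,
    Quaternion.norm_coe, Real.norm_of_nonneg hN, Quaternion.norm_star_mul_sub_star_mul,
    Real.sq_sqrt (by positivity), Real.sqrt_eq_iff_mul_self_eq (by positivity) (by positivity)]
  ring
end
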